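/- arXiv:1604.08779 — 2 statements merged into one kernel-verified Lean document; each statement's English description precedes it below -/
import Mathlib

section
/- In the robot game with states G(Q,T), suppose Adam has played only the 0-move (0,0) and Eve, instead of a simulating move, plays the connecting move (s_{ab},(−1,0),⊤_{ab}) from a configuration whose first counter is congruent to 0 modulo 4. Then Adam has a winning strategy from the resulting configuration (Adam to move), starting with the 0-move (0,0). -/
/-- A transition of a two-counter machine: `(source, counter index (0 or 1),
operation (0 = increment, 1 = decrement, 2 = zero-test), target)`. -/
abbrev CMTrans : Type := ℕ × ℕ × ℕ × ℕ

/-- A two-counter Minsky machine: a finite list of transitions together with the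
sink state `⊥`; the initial state is `0`. -/
abbrev TwoCM : Type := List CMTrans × ℕ

/-- The list of states of a machine (the initial state `0`, the sink, and all
states mentioned in transitions). -/
def cmStates (M : TwoCM) : List ℕ :=
  0 :: M.2 :: (M.1.map (fun t => t.1) ++ M.1.map (fun t => t.2.2.2))

/-- The outgoing transitions of a state. -/
def cmOutgoing (M : TwoCM) (s : ℕ) : List CMTrans := M.1.filter (fun t => t.1 = s)

/-- The machine is a deterministic two-counter Minsky machine: counter indices and
operations are in range, the sink state has no outgoing transition, and every
other state has either exactly one outgoing transition, labelled by an increment,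
or exactly two outgoing transitions, labelled by a decrement and a zero-test of
the same counter. -/
def CMDeterministic (M : TwoCM) : Prop :=
  (∀ t ∈ M.1, t.2.1 < 2 ∧ t.2.2.1 < 3) ∧
  cmOutgoing M M.2 = [] ∧
  ∀ s ∈ cmStates M, s ≠ M.2 →
    ((∃ i u, cmOutgoing M s = [(s, i, 0, u)]) ∨
     (∃ i u v, (cmOutgoing M s).Perm [(s, i, 1, u), (s, i, 2, v)]))

/-- The value of counter `i`. -/
def cmGet (i : ℕ) (c : ℕ × ℕ) : ℕ := if i = 0 then c.1 else c.2

/-- Setting the value of counter `i`. -/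
def cmSet (i : ℕ) (v : ℕ) (c : ℕ × ℕ) : ℕ × ℕ := if i = 0 then (v, c.2) else (c.1, v)

/-- Semantics of operation `op` (0 = increment, 1 = decrement, 2 = zero-test) on
counter `i`: a decrement is enabled only if the counter is positive, and the
zero-test only if the counter is zero. -/
def CMCounterSem (i op : ℕ) (c c' : ℕ × ℕ) : Prop :=
  (op = 0 ∧ c' = cmSet i (cmGet i c + 1) c) ∨
  (op = 1 ∧ 0 < cmGet i c ∧ c' = cmSet i (cmGet i c - 1) c) ∨
  (op = 2 ∧ cmGet i c = 0 ∧ c' = c)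

/-- One step of the machine on configurations `(state, counters)`. -/
def CMStep (M : TwoCM) (c c' : ℕ × ℕ × ℕ) : Prop :=
  ∃ i op, (c.1, i, op, c'.1) ∈ M.1 ∧ CMCounterSem i op c.2 c'.2

/-- The initial configuration `(s₀, (0, 0))`. -/
def cmInit : ℕ × ℕ × ℕ := (0, 0, 0)

/-- The first transition of the run increments a counter. -/
def CMFirstIncrements (M : TwoCM) : Prop := ∃ t ∈ M.1, t.1 = 0 ∧ t.2.2.1 = 0

/-- The run of the machine visits a configuration in `Q × {(0,0)}` after the
initial configuration. -/
def CMReachesZeroZero (M : TwoCM) : Prop :=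
  ∃ c₁ c, CMStep M cmInit c₁ ∧ Relation.ReflTransGen (CMStep M) c₁ c ∧ c.2 = (0, 0)

/-- The run of the machine reaches a configuration in `{⊥} × ℕ²`. -/
def CMReachesSink (M : TwoCM) : Prop :=
  ∃ c, Relation.ReflTransGen (CMStep M) cmInit c ∧ c.1 = M.2

/-- A state of the flag machine `(Q',T')`: a state of the original machine
together with two positivity flags (`true` = `+`, `false` = `0`). -/
abbrev FState : Type := ℕ × Bool × Bool

/-- The transitions of the flag machine `(Q',T')` constructed from `M`. -/
def FlagTrans (M : TwoCM) (p : FState) (i op : ℕ) (q : FState) : Prop :=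
  (p.1, i, op, q.1) ∈ M.1 ∧
  ((op = 0 ∧ i = 0 ∧ q.2.1 = true ∧ q.2.2 = p.2.2) ∨
   (op = 0 ∧ i = 1 ∧ q.2.1 = p.2.1 ∧ q.2.2 = true) ∨
   (op = 1 ∧ i = 0 ∧ p.2.1 = true ∧ q.2.2 = p.2.2) ∨
   (op = 1 ∧ i = 1 ∧ p.2.2 = true ∧ q.2.1 = p.2.1) ∨
   (op = 2 ∧ i = 0 ∧ p.2.1 = false ∧ q.2.1 = false ∧ q.2.2 = p.2.2) ∨
   (op = 2 ∧ i = 1 ∧ p.2.2 = false ∧ q.2.2 = false ∧ q.2.1 = p.2.1))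

/-- The flags match the counter values: a flag is `+` iff the counter is positive. -/
def FlagsMatch (ab : Bool × Bool) (c : ℕ × ℕ) : Prop :=
  ab.1 = decide (0 < c.1) ∧ ab.2 = decide (0 < c.2)

/-- A configuration of a robot game with states: a control state of Eve together
with the two integer counters. -/
abbrev RGSConf (S : Type) : Type := S × ℤ × ℤ

/-- A move of Eve in a robot game with states: source state, vector, target state. -/
abbrev RGSEMove (S : Type) : Type := S × (ℤ × ℤ) × S

/-- A history of a play: the rounds played so far, each round consisting of Adam's
vector followed by Eve's move. -/
abbrev RGSHist (S : Type) : Type := List ((ℤ × ℤ) × RGSEMove S)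

/-- A strategy of Eve: a function from histories and Adam's current vector to a move. -/
abbrev RGSEStrat (S : Type) : Type := RGSHist S → (ℤ × ℤ) → RGSEMove S

/-- A strategy of Adam: a function from histories to a vector. -/
abbrev RGSAStrat (S : Type) : Type := RGSHist S → ℤ × ℤ

/-- The configuration reached from `c0` after playing the history `h`. -/
def rgsConfAfter {S : Type} (c0 : RGSConf S) (h : RGSHist S) : RGSConf S :=
  h.foldl (fun c mv => (mv.2.2.2, c.2 + mv.1 + mv.2.2.1)) c0

/-- The history of the first `k` rounds when Eve plays `σ` and Adam plays `τ`. -/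
def rgsPlay {S : Type} (σ : RGSEStrat S) (τ : RGSAStrat S) : ℕ → RGSHist S
  | 0 => []
  | k + 1 =>
      rgsPlay σ τ k ++
        [(τ (rgsPlay σ τ k), σ (rgsPlay σ τ k) (τ (rgsPlay σ τ k)))]

/-- Eve's move in round `k` is legal: it belongs to `E` and its source state is
the current control state. -/
def RGSEveLegal {S : Type} (E : Set (RGSEMove S)) (c0 : RGSConf S)
    (σ : RGSEStrat S) (τ : RGSAStrat S) (k : ℕ) : Prop :=
  σ (rgsPlay σ τ k) (τ (rgsPlay σ τ k)) ∈ E ∧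
    (σ (rgsPlay σ τ k) (τ (rgsPlay σ τ k))).1 = (rgsConfAfter c0 (rgsPlay σ τ k)).1

/-- The play of `σ` against `τ` from `c0` is won by Eve: at some round Eve has
played legally so far and the counters are `(0, 0)` after her move. -/
def RGSEveWinsPlay {S : Type} (E : Set (RGSEMove S)) (c0 : RGSConf S)
    (σ : RGSEStrat S) (τ : RGSAStrat S) : Prop :=
  ∃ k, (∀ j ≤ k, RGSEveLegal E c0 σ τ j) ∧
    (rgsConfAfter c0 (rgsPlay σ τ (k + 1))).2 = 0

/-- Eve has a winning strategy from configuration `c0` (Adam to move): she has a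
strategy such that every play consistent with it is won by her. -/
def RGSEveWins {S : Type} (E : Set (RGSEMove S)) (A : Set (ℤ × ℤ))
    (c0 : RGSConf S) : Prop :=
  ∃ σ : RGSEStrat S, ∀ τ : RGSAStrat S,
    (∀ k, τ (rgsPlay σ τ k) ∈ A) → RGSEveWinsPlay E c0 σ τ

/-- Adam has a winning strategy from configuration `c0` (Adam to move): he has a
(legal) strategy such that no play consistent with it is won by Eve. -/
def RGSAdamWins {S : Type} (E : Set (RGSEMove S)) (A : Set (ℤ × ℤ))
    (c0 : RGSConf S) : Prop :=
  ∃ τ : RGSAStrat S, (∀ σ k, τ (rgsPlay σ τ k) ∈ A) ∧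
    ∀ σ, ¬ RGSEveWinsPlay E c0 σ τ

/-- A control state of Eve in the game `G(Q,T)`: a flagged machine state (`inl`)
or one of the four emptying states `⊤ab` (`inr`). -/
abbrev GState : Type := FState ⊕ (Bool × Bool)

/-- The vector of Eve's simulating move for the label `(i, op)`: increments and
decrements of the first counter are multiplied by `4`. -/
def simVec (i op : ℕ) : ℤ × ℤ :=
  if op = 0 then (if i = 0 then (4, 0) else (0, 1))
  else if op = 1 then (if i = 0 then (-4, 0) else (0, -1))
  else (0, 0)

/-- Eve's moves in the robot game with states `G(Q,T)`: the simulating moves, the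
connecting moves `(s_ab, (-1,0), ⊤_ab)`, and the emptying moves. -/
def gameE (M : TwoCM) : Set (RGSEMove GState) :=
  { m | (∃ p i op q, FlagTrans M p i op q ∧ m = (Sum.inl p, simVec i op, Sum.inl q)) ∨
        (∃ s a b, s ∈ cmStates M ∧
          m = (Sum.inl (s, a, b), ((-1 : ℤ), (0 : ℤ)), Sum.inr (a, b))) ∨
        (∃ e : ℤ, (e = 0 ∨ e = 1) ∧
          ((∃ t : Bool × Bool, m = (Sum.inr (true, true), (-4 - e, -1), Sum.inr t)) ∨
           (∃ t : Bool × Bool, (t = (true, false) ∨ t = (false, false)) ∧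
             m = (Sum.inr (true, false), (-4 - e, 0), Sum.inr t)) ∨
           (∃ t : Bool × Bool, (t = (false, true) ∨ t = (false, false)) ∧
             m = (Sum.inr (false, true), (-e, -1), Sum.inr t)) ∨
           m = (Sum.inr (false, false), (-e, 0), Sum.inr (false, false)))) }

/-- Adam's moves in `G(Q,T)`: the 0-move `(0,0)` and the positivity check `(1,0)`. -/
def gameA : Set (ℤ × ℤ) := {((0 : ℤ), (0 : ℤ)), ((1 : ℤ), (0 : ℤ))}

/-- The game configuration encoding a configuration of the flag machine: the
first counter is multiplied by `4`. -/
def encodeConf (c : FState × ℕ × ℕ) : RGSConf GState :=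
  (Sum.inl c.1, (4 * (c.2.1 : ℤ), (c.2.2 : ℤ)))

theorem rgsConfAfter_rgsPlay_succ {S : Type} (c0 : RGSConf S) (σ : RGSEStrat S)
    (τ : RGSAStrat S) (k : ℕ) :
    rgsConfAfter c0 (rgsPlay σ τ (k + 1)) =
      ((σ (rgsPlay σ τ k) (τ (rgsPlay σ τ k))).2.2,
        (rgsConfAfter c0 (rgsPlay σ τ k)).2 + τ (rgsPlay σ τ k) +
          (σ (rgsPlay σ τ k) (τ (rgsPlay σ τ k))).2.1) := by
  simp [rgsPlay, rgsConfAfter]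

/-- From an emptying state, Eve can only go to an emptying state, and modulo `4` she subtracts
`0` or `1` from the first counter. -/
theorem gameE_emptying_move {M : TwoCM} {m : RGSEMove GState} (hm : m ∈ gameE M)
    {ab : Bool × Bool} (hsrc : m.1 = Sum.inr ab) :
    (∃ t, m.2.2 = Sum.inr t) ∧ (m.2.1.1 % 4 = 0 ∨ m.2.1.1 % 4 = 3) := by
  rcases hm with ⟨p, i, op, q, -, rfl⟩ | ⟨s, a, b, -, rfl⟩ |
    ⟨e, he, ⟨t, rfl⟩ | ⟨t, -, rfl⟩ | ⟨t, -, rfl⟩ | rfl⟩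
  · simp at hsrc
  · simp at hsrc
  all_goals
    refine ⟨⟨_, rfl⟩, ?_⟩
    dsimp only
    omega

/-- Adam's strategy that plays the positivity check exactly when the first counter is congruent
to `2` modulo `4`. -/
def residueStrat (c0 : RGSConf GState) : RGSAStrat GState :=
  fun h => if (rgsConfAfter c0 h).2.1 % 4 = 2 then (1, 0) else (0, 0)

theorem residueStrat_mem_gameA (c0 : RGSConf GState) (h : RGSHist GState) :
    residueStrat c0 h ∈ gameA := by
  unfold residueStrat gameA
  split_ifs <;> simp

/-- Against `residueStrat`, a play starting in an emptying state with first counter congruent to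
`2` or `3` modulo `4` keeps both properties as long as Eve plays legally. -/
theorem residueStrat_invariant {M : TwoCM} {c0 : RGSConf GState} {σ : RGSEStrat GState}
    (hstate : ∃ t, c0.1 = Sum.inr t) (hres : c0.2.1 % 4 = 2 ∨ c0.2.1 % 4 = 3) (k : ℕ)
    (hlegal : ∀ j < k, RGSEveLegal (gameE M) c0 σ (residueStrat c0) j) :
    (∃ t, (rgsConfAfter c0 (rgsPlay σ (residueStrat c0) k)).1 = Sum.inr t) ∧
      ((rgsConfAfter c0 (rgsPlay σ (residueStrat c0) k)).2.1 % 4 = 2 ∨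
        (rgsConfAfter c0 (rgsPlay σ (residueStrat c0) k)).2.1 % 4 = 3) := by
  induction k with
  | zero => exact ⟨hstate, hres⟩
  | succ k ih =>
    obtain ⟨⟨t, ht⟩, hk⟩ := ih fun j hj => hlegal j (by omega)
    obtain ⟨hmem, hsrc⟩ := hlegal k (by omega)
    obtain ⟨htgt, hvec⟩ := gameE_emptying_move hmem (hsrc.trans ht)
    rw [rgsConfAfter_rgsPlay_succ]
    refine ⟨htgt, ?_⟩
    have hadam : (residueStrat c0 (rgsPlay σ (residueStrat c0) k)).1 =
        if (rgsConfAfter c0 (rgsPlay σ (residueStrat c0) k)).2.1 % 4 = 2 then 1 else 0 := by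
      rw [residueStrat]
      split_ifs <;> rfl
    simp only [Prod.fst_add]
    split_ifs at hadam <;> omega

/-- In the game `G(Q,T)`, if Adam has played only the 0-move and
Eve plays the connecting move `(s_ab, (-1,0), ⊤_ab)` from a configuration whose
first counter is congruent to `0` modulo `4`, then Adam has a winning strategy
from the resulting configuration (Adam to move), starting with the 0-move `(0,0)`. -/
theorem adam_wins_after_premature_emptying (M : TwoCM) (hdet : CMDeterministic M)
    (s : ℕ) (hs : s ∈ cmStates M) (a b : Bool) (v : ℤ × ℤ)
    (hdiv : (4 : ℤ) ∣ v.1) :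
    ∃ τ : RGSAStrat GState, τ [] = ((0 : ℤ), (0 : ℤ)) ∧
      (∀ σ k, τ (rgsPlay σ τ k) ∈ gameA) ∧
      ∀ σ, ¬ RGSEveWinsPlay (gameE M) (Sum.inr (a, b), (v.1 - 1, v.2)) σ τ := by
  have hres : (v.1 - 1) % 4 = 3 := by omega
  refine ⟨residueStrat (Sum.inr (a, b), (v.1 - 1, v.2)), ?_,
    fun _ _ => residueStrat_mem_gameA _ _, ?_⟩
  · simp [residueStrat, rgsConfAfter, hres]
  · rintro σ ⟨k, hlegal, hzero⟩
    obtain ⟨-, hk⟩ := residueStrat_invariant ⟨(a, b), rfl⟩ (Or.inr hres) (k + 1)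
      fun j hj => hlegal j (by omega)
    rw [hzero] at hk
    simp at hk
end

section
/- It is undecidable whether Eve has a winning strategy in a two-dimensional robot game with states: under a fixed effective encoding of instances, the set of codes of triples (A,E,(s0,x0)) — where (A,E) is a two-dimensional robot game with states in which Adam is stateless and none of Adam's moves modifies the second counter, and (s0,x0) is an initial configuration — such that Eve has a winning strategy to reach counters (0,0) from (s0,x0), is not a computable set. -/
/-- The data of an instance of the decision problem for two-dimensional robot
games with states (with stateless Adam): Eve's moves, Adam's moves, and the
initial configuration `(s0, x0)`; the fixed effective encoding is
`Encodable.encode` on this type. -/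
abbrev RGSData : Type := List (RGSEMove ℕ) × List (ℤ × ℤ) × ℕ × (ℤ × ℤ)

/-! ### Forcing positions and trapping invariants in robot games -/

/-- Eve can force a visit to `(0, 0)` from the configuration `c`. -/
inductive EveForces {S : Type} (E : Set (RGSEMove S)) (A : Set (ℤ × ℤ)) : RGSConf S → Prop
  | intro (c : RGSConf S) (m : ℤ × ℤ → RGSEMove S)
      (legal : ∀ a ∈ A, m a ∈ E ∧ (m a).1 = c.1)
      (next : ∀ a ∈ A, c.2 + a + (m a).2.1 ≠ 0 →
        EveForces E A ((m a).2.2, c.2 + a + (m a).2.1)) : EveForces E A c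

theorem rgsConfAfter_cons {S : Type} (c : RGSConf S) (x : (ℤ × ℤ) × RGSEMove S)
    (h : RGSHist S) :
    rgsConfAfter c (x :: h) = rgsConfAfter (x.2.2.2, c.2 + x.1 + x.2.2.1) h := rfl

theorem rgsConfAfter_append_singleton {S : Type} (c : RGSConf S) (h : RGSHist S)
    (x : (ℤ × ℤ) × RGSEMove S) :
    rgsConfAfter c (h ++ [x]) = (x.2.2.2, (rgsConfAfter c h).2 + x.1 + x.2.2.1) := by
  simp [rgsConfAfter]

/-- Dropping the first round of a play. -/
theorem rgsPlay_succ_eq_cons {S : Type} (σ : RGSEStrat S) (τ : RGSAStrat S) (k : ℕ) :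
    rgsPlay σ τ (k + 1) = (τ [], σ [] (τ [])) ::
      rgsPlay (fun h => σ ((τ [], σ [] (τ [])) :: h))
        (fun h => τ ((τ [], σ [] (τ [])) :: h)) k := by
  induction k with
  | zero => rfl
  | succ k ih => rw [rgsPlay, ih]; rfl

theorem EveForces.eveWins {S : Type} {E : Set (RGSEMove S)} {A : Set (ℤ × ℤ)}
    {c : RGSConf S} (h : EveForces E A c) : RGSEveWins E A c := by
  classical
  induction h with
  | intro c m legal _ ih =>
    have : Nonempty (RGSEStrat S) := ⟨fun _ => m⟩
    choose! σ hσ using ih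
    refine ⟨fun h b => match h with
      | [] => m b
      | x :: h => σ x.1 h b, fun τ hτ => ?_⟩
    set ρ : RGSEStrat S := fun h b => match h with
      | [] => m b
      | x :: h => σ x.1 h b with hρ
    have ha : τ [] ∈ A := hτ 0
    have legal_zero : RGSEveLegal E c ρ τ 0 := legal _ ha
    by_cases h0 : c.2 + τ [] + (m (τ [])).2.1 = 0
    · refine ⟨0, fun j hj => ?_, h0⟩
      obtain rfl : j = 0 := by omega
      exact legal_zero
    · have play (k : ℕ) : rgsPlay ρ τ (k + 1) = (τ [], m (τ [])) ::
          rgsPlay (σ (τ [])) (fun h => τ ((τ [], m (τ [])) :: h)) k :=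
        rgsPlay_succ_eq_cons ρ τ k
      obtain ⟨k, hk, hwin⟩ := hσ _ ha h0 (fun h => τ ((τ [], m (τ [])) :: h)) fun k => by
        rw [← play]
        exact hτ (k + 1)
      refine ⟨k + 1, fun j hj => ?_, ?_⟩
      · cases j with
        | zero => exact legal_zero
        | succ j =>
          have := hk j (by omega)
          unfold RGSEveLegal at this ⊢
          rw [play, rgsConfAfter_cons]
          exact this
      · rw [play, rgsConfAfter_cons]
        exact hwin

/-- If Adam can maintain the invariant `P` while avoiding `(0, 0)`, then Eve does not win. -/
theorem not_eveWins_of_invariant {S : Type} {E : Set (RGSEMove S)} {A : Set (ℤ × ℤ)}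
    (P : RGSConf S → Prop)
    (step : ∀ c, P c → ∃ a ∈ A, ∀ m ∈ E, m.1 = c.1 →
      c.2 + a + m.2.1 ≠ 0 ∧ P (m.2.2, c.2 + a + m.2.1))
    {c : RGSConf S} (hc : P c) : ¬ RGSEveWins E A c := by
  classical
  rintro ⟨σ, hσ⟩
  obtain ⟨a₀, ha₀, -⟩ := step c hc
  choose! α hα hstep using step
  obtain ⟨k, hk, hwin⟩ := hσ
    (fun h => if P (rgsConfAfter c h) then α (rgsConfAfter c h) else a₀) fun k => by
      split_ifs with hP
      · exact hα _ hP
      · exact ha₀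
  set τ : RGSAStrat S :=
    fun h => if P (rgsConfAfter c h) then α (rgsConfAfter c h) else a₀ with hτ
  have key (j : ℕ) (hj : j ≤ k) (hP : P (rgsConfAfter c (rgsPlay σ τ j))) :
      (rgsConfAfter c (rgsPlay σ τ (j + 1))).2 ≠ 0 ∧
        P (rgsConfAfter c (rgsPlay σ τ (j + 1))) := by
    have h1 : τ (rgsPlay σ τ j) = α (rgsConfAfter c (rgsPlay σ τ j)) := if_pos hP
    obtain ⟨hE, hsrc⟩ := hk j hj
    rw [rgsPlay, rgsConfAfter_append_singleton]
    have := hstep _ hP _ hE hsrc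
    rw [← h1] at this
    exact this
  have inv (j : ℕ) (hj : j ≤ k) : P (rgsConfAfter c (rgsPlay σ τ j)) := by
    induction j with
    | zero => exact hc
    | succ j ih => exact (key j (by omega) (ih (by omega))).2
  exact (key k le_rfl (inv k le_rfl)).1 hwin

/-! ### Affine rewriting machines and their games -/

/-- A rule of an affine rewriting machine: in state `src`, a number of the form `m * k + r`
may be replaced by `a * k + b`, moving to state `tgt`. -/
structure AffineRule (S : Type) where
  src : S
  m : ℕ
  r : ℕ
  a : ℕ
  b : ℕ
  tgt : S
  deriving Countable

/-- One step of the affine rewriting machine with rules `R`. -/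
def AffineStep {S : Type} (R : List (AffineRule S)) (c d : S × ℕ) : Prop :=
  ∃ ρ ∈ R, ∃ k, ρ.src = c.1 ∧ c.2 = ρ.m * k + ρ.r ∧ d = (ρ.tgt, ρ.a * k + ρ.b)

/-- The machine with rules `R` can reach the state `h` from the configuration `c`. -/
def AffineHalts {S : Type} (R : List (AffineRule S)) (h : S) (c : S × ℕ) : Prop :=
  ∃ N, Relation.ReflTransGen (AffineStep R) c (h, N)

/-- Eve's control states in the game of an affine rewriting machine. The Boolean tells which
counter holds the current number: `false` for the first one, `true` for the second one. -/
inductive AffineGameState (S : Type) : Type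
  | main (s : S) (side : Bool)
  | loop (ρ : AffineRule S) (side : Bool)
  | check (side : Bool)
  deriving Countable

/-- The counter values representing `u` in the active and `v` in the passive counter. -/
def gamePos (side : Bool) (u v : ℤ) : ℤ × ℤ :=
  bif side then (3 * v, u) else (3 * u, v)

/-- The first counter shift that Adam uses to signal `β`. -/
def signal (β : Bool) : ℤ × ℤ := (bif β then 1 else 0, 0)

/-- Eve's vector that cancels the signal `β` and changes the active counter by `u` and
the passive counter by `v`. -/
def gameVec (side β : Bool) (u v : ℤ) : ℤ × ℤ :=
  gamePos side u v - signal β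

/-- Eve's abstract moves `AffineMove R h β side g u v g'` as an answer to the signal `β`: from
state `g` to `g'`, changing the active counter by `u` and the passive counter by `v`. -/
inductive AffineMove {S : Type} (R : List (AffineRule S)) (h : S) :
    Bool → Bool → AffineGameState S → ℤ → ℤ → AffineGameState S → Prop
  | halt (β side) : AffineMove R h β side (.main h side) 0 0 (.check side)
  | down (β side) : AffineMove R h β side (.check side) (-1) 0 (.check side)
  | choose (side) {ρ} (hρ : ρ ∈ R) :
      AffineMove R h false side (.main ρ.src side) 0 0 (.loop ρ side)
  | verify (side) {ρ} (hρ : ρ ∈ R) :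
      AffineMove R h true side (.main ρ.src side) 0 0 (.check side)
  | iter (β side) {ρ} (hρ : ρ ∈ R) :
      AffineMove R h β side (.loop ρ side) (-ρ.m) ρ.a (.loop ρ side)
  | leave (β side) {ρ} (hρ : ρ ∈ R) :
      AffineMove R h β side (.loop ρ side) (-ρ.r) ρ.b (.main ρ.tgt (!side))

/-- The list of Eve's moves, with control states numbered by `φ`. -/
def affineMoves {S : Type} (R : List (AffineRule S)) (h : S) (φ : AffineGameState S → ℕ) :
    List (RGSEMove ℕ) :=
  [false, true].flatMap fun β => [false, true].flatMap fun side =>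
    (φ (.main h side), gameVec side β 0 0, φ (.check side)) ::
    (φ (.check side), gameVec side β (-1) 0, φ (.check side)) ::
    R.flatMap fun ρ =>
      [(φ (.main ρ.src side), gameVec side false 0 0, φ (.loop ρ side)),
        (φ (.main ρ.src side), gameVec side true 0 0, φ (.check side)),
        (φ (.loop ρ side), gameVec side β (-ρ.m) ρ.a, φ (.loop ρ side)),
        (φ (.loop ρ side), gameVec side β (-ρ.r) ρ.b, φ (.main ρ.tgt (!side)))]

theorem mem_affineMoves {S : Type} {R : List (AffineRule S)} {h : S}
    {φ : AffineGameState S → ℕ} {e : RGSEMove ℕ} :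
    e ∈ affineMoves R h φ ↔ ∃ β side g u v g', AffineMove R h β side g u v g' ∧
      e = (φ g, gameVec side β u v, φ g') := by
  constructor
  · intro he
    simp only [affineMoves, List.mem_flatMap, List.mem_cons, List.not_mem_nil, or_false] at he
    obtain ⟨β, -, side, -, rfl | rfl | ⟨ρ, hρ, rfl | rfl | rfl | rfl⟩⟩ := he
    · exact ⟨_, _, _, _, _, _, .halt β side, rfl⟩
    · exact ⟨_, _, _, _, _, _, .down β side, rfl⟩
    · exact ⟨_, _, _, _, _, _, .choose side hρ, rfl⟩
    · exact ⟨_, _, _, _, _, _, .verify side hρ, rfl⟩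
    · exact ⟨_, _, _, _, _, _, .iter β side hρ, rfl⟩
    · exact ⟨_, _, _, _, _, _, .leave β side hρ, rfl⟩
  · rintro ⟨β, side, g, u, v, g', hm, rfl⟩
    simp only [affineMoves, List.mem_flatMap, List.mem_cons, List.not_mem_nil, or_false]
    refine ⟨β, by cases β <;> simp, side, by cases side <;> simp, ?_⟩
    cases hm with
    | halt => exact .inl rfl
    | down => exact .inr (.inl rfl)
    | choose _ hρ => exact .inr (.inr ⟨_, hρ, .inl rfl⟩)
    | verify _ hρ => exact .inr (.inr ⟨_, hρ, .inr (.inl rfl)⟩)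
    | iter _ _ hρ => exact .inr (.inr ⟨_, hρ, .inr (.inr (.inl rfl))⟩)
    | leave _ _ hρ => exact .inr (.inr ⟨_, hρ, .inr (.inr (.inr rfl))⟩)

theorem gamePos_add (side : Bool) (u v u' v' : ℤ) :
    gamePos side u v + gamePos side u' v' = gamePos side (u + u') (v + v') := by
  cases side <;> simp [gamePos, mul_add]

theorem gamePos_add_signal_add_gameVec (side β : Bool) (u v u' v' : ℤ) :
    gamePos side u v + signal β + gameVec side β u' v' = gamePos side (u + u') (v + v') := by
  rw [← gamePos_add, gameVec]
  abel

theorem gamePos_eq_zero {side : Bool} {u v : ℤ} : gamePos side u v = 0 ↔ u = 0 ∧ v = 0 := by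
  cases side <;> simp [gamePos, Prod.ext_iff, and_comm]

theorem gamePos_not (side : Bool) (u v : ℤ) : gamePos (!side) u v = gamePos side v u := by
  cases side <;> rfl

theorem gamePos_fst_emod (side : Bool) (u v : ℤ) : (gamePos side u v).1 % 3 = 0 := by
  cases side <;> simp [gamePos]

section Game

variable {S : Type} {R : List (AffineRule S)} {h : S} {φ : AffineGameState S → ℕ}

/-- Eve's moves as a set. -/
abbrev affineE (R : List (AffineRule S)) (h : S) (φ : AffineGameState S → ℕ) :
    Set (RGSEMove ℕ) := {e | e ∈ affineMoves R h φ}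

/-- Adam's moves: he adds `0` or `1` to the first counter. -/
abbrev signalMoves : Set (ℤ × ℤ) := {a | a ∈ [signal false, signal true]}

theorem eveForces_of_moves {g : AffineGameState S} {side : Bool} {u v : ℤ}
    (H : ∀ β, ∃ u' v' g', AffineMove R h β side g u' v' g' ∧
      (gamePos side (u + u') (v + v') ≠ 0 →
        EveForces (affineE R h φ) signalMoves (φ g', gamePos side (u + u') (v + v')))) :
    EveForces (affineE R h φ) signalMoves (φ g, gamePos side u v) := by
  choose u' v' g' hm hnext using H
  have key (a : ℤ × ℤ) (ha : a ∈ signalMoves) : a = signal (decide (a = signal true)) := by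
    simp only [signalMoves, Set.mem_ofPred_eq, List.mem_cons, List.not_mem_nil, or_false] at ha
    obtain rfl | rfl := ha <;> simp [signal]
  refine .intro _ (fun a => (φ g, gameVec side (decide (a = signal true)) (u' _) (v' _),
    φ (g' (decide (a = signal true))))) (fun a _ => ⟨mem_affineMoves.2
      ⟨_, _, _, _, _, _, hm (decide (a = signal true)), rfl⟩, rfl⟩) fun a ha => ?_
  generalize hβ : decide (a = signal true) = β
  have := key a ha
  rw [hβ] at this
  subst this
  dsimp only
  rw [gamePos_add_signal_add_gameVec]
  exact hnext β

theorem eveForces_check (side : Bool) (u : ℕ) :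
    EveForces (affineE R h φ) signalMoves (φ (.check side), gamePos side (u + 1) 0) := by
  induction u with
  | zero =>
    refine eveForces_of_moves fun β => ⟨_, _, _, .down β side, fun hne => (hne ?_).elim⟩
    simp [gamePos_eq_zero]
  | succ u ih =>
    refine eveForces_of_moves fun β => ⟨_, _, _, .down β side, fun _ => ?_⟩
    simpa using ih

theorem eveForces_check_of_pos (side : Bool) {u : ℕ} (hu : 0 < u) :
    EveForces (affineE R h φ) signalMoves (φ (.check side), gamePos side u 0) := by
  obtain ⟨u, rfl⟩ := Nat.exists_eq_add_of_lt hu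
  simpa using eveForces_check side u

theorem eveForces_loop {ρ : AffineRule S} (hρ : ρ ∈ R) (side : Bool) (k : ℕ) (v : ℤ)
    (H : EveForces (affineE R h φ) signalMoves
      (φ (.main ρ.tgt (!side)), gamePos (!side) (v + ρ.a * k + ρ.b) 0)) :
    EveForces (affineE R h φ) signalMoves
      (φ (.loop ρ side), gamePos side (ρ.m * k + ρ.r) v) := by
  induction k generalizing v with
  | zero =>
    refine eveForces_of_moves fun β => ⟨_, _, _, .leave β side hρ, fun _ => ?_⟩
    rw [gamePos_not] at H
    simpa using H
  | succ k ih =>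
    refine eveForces_of_moves fun β => ⟨_, _, _, .iter β side hρ, fun _ => ?_⟩
    convert ih (v + ρ.a) _ using 3
    · push_cast; ring
    · convert H using 3
      push_cast; ring

theorem eveForces_main_of_halts (hR : ∀ ρ ∈ R, 0 < ρ.a ∧ (0 < ρ.r → 0 < ρ.b)) {c : S × ℕ}
    (hc : AffineHalts R h c) (hpos : 0 < c.2) (side : Bool) :
    EveForces (affineE R h φ) signalMoves (φ (.main c.1 side), gamePos side c.2 0) := by
  obtain ⟨N, hN⟩ := hc
  induction hN using Relation.ReflTransGen.head_induction_on generalizing side with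
  | refl =>
    refine eveForces_of_moves fun β => ⟨_, _, _, .halt β side, fun _ => ?_⟩
    simpa using eveForces_check_of_pos side hpos
  | head hstep _ ih =>
    rename_i c d
    obtain ⟨ρ, hρ, k, hsrc, hc, rfl⟩ := hstep
    rw [← hsrc]
    refine eveForces_of_moves fun β => ?_
    cases β with
    | true =>
      refine ⟨_, _, _, .verify side hρ, fun _ => ?_⟩
      simpa using eveForces_check_of_pos side hpos
    | false =>
      refine ⟨_, _, _, .choose side hρ, fun _ => ?_⟩
      have hd : 0 < ρ.a * k + ρ.b := by
        obtain ⟨ha, hb⟩ := hR ρ hρ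
        rcases Nat.eq_zero_or_pos k with rfl | hk
        · have := hb (by simpa [hc] using hpos)
          omega
        · have := Nat.mul_pos ha hk
          omega
      have := eveForces_loop (h := h) (φ := φ) hρ side k 0 (by simpa using ih hd (!side))
      simpa [hc] using this

/-- The abstract positions from which Adam refutes Eve. -/
inductive Refuted (R : List (AffineRule S)) (h : S) :
    Bool → AffineGameState S → ℤ → ℤ → Prop
  | check {side u v} (hv : v ≠ 0) : Refuted R h side (.check side) u v
  | cheat {side s u v} (hv : v ≠ 0) : Refuted R h side (.main s side) u v
  | main {side s} {N : ℕ} (hN : 0 < N) (hh : ¬ AffineHalts R h (s, N)) :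
      Refuted R h side (.main s side) N 0
  | loop {side ρ} {N k : ℕ} (hN : 0 < N) (hh : ¬ AffineHalts R h (ρ.src, N)) :
      Refuted R h side (.loop ρ side) (N - ρ.m * k) (ρ.a * k)

theorem AffineHalts.of_step {c d : S × ℕ} (hs : AffineStep R c d)
    (hd : AffineHalts R h d) : AffineHalts R h c :=
  hd.imp fun _ hN => .head hs hN

theorem AffineMove.side_unique {β side side' : Bool} {g g' : AffineGameState S} {u v u' v' : ℤ}
    (hm : AffineMove R h β side' g u' v' g') (hr : Refuted R h side g u v) : side' = side := by
  cases hr <;> cases hm <;> rfl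

/-- In a refuted position Adam has a signal such that all of Eve's proper answers lead to
refuted positions different from `(0, 0)`. -/
theorem Refuted.exists_signal (hR : ∀ ρ ∈ R, 0 < ρ.a ∧ (0 < ρ.r → 0 < ρ.b))
    {side : Bool} {g : AffineGameState S} {u v : ℤ} (hr : Refuted R h side g u v) :
    ∃ β, ∀ u' v' g', AffineMove R h β side g u' v' g' →
      ¬ (u + u' = 0 ∧ v + v' = 0) ∧
        ∃ side' u₁ v₁, gamePos side (u + u') (v + v') = gamePos side' u₁ v₁ ∧
          Refuted R h side' g' u₁ v₁ := by
  cases hr with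
  | check hv =>
    refine ⟨false, fun u' v' g' hm => ?_⟩
    cases hm
    simp only [add_zero]
    exact ⟨fun h => hv h.2, _, _, _, rfl, .check hv⟩
  | cheat hv =>
    refine ⟨true, fun u' v' g' hm => ?_⟩
    cases hm <;> simp only [add_zero] <;> exact ⟨fun h => hv h.2, _, _, _, rfl, .check hv⟩
  | @main s N hN hh =>
    refine ⟨false, fun u' v' g' hm => ?_⟩
    cases hm with
    | halt => exact (hh ⟨N, .refl⟩).elim
    | choose _ hρ =>
      refine ⟨by omega, side, _, _, ?_, .loop (k := 0) hN hh⟩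
      simp
  | @loop ρ N k hN hh =>
    refine ⟨false, fun u' v' g' hm => ?_⟩
    cases hm with
    | iter _ _ hρ =>
      refine ⟨?_, side, _, _, ?_, .loop (k := k + 1) hN hh⟩
      · rintro ⟨-, h2⟩
        have := (hR ρ hρ).1
        have : (0 : ℤ) ≤ ρ.a * k := by positivity
        omega
      · congr 1
        all_goals
          push_cast
          ring
    | leave _ _ hρ =>
      by_cases h1 : (N : ℤ) - ρ.m * k + -ρ.r = 0
      · have hNk : N = ρ.m * k + ρ.r := by zify; linarith
        have hd : 0 < ρ.a * k + ρ.b := by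
          obtain ⟨ha, hb⟩ := hR ρ hρ
          rcases Nat.eq_zero_or_pos k with rfl | hk
          · have := hb (by omega)
            omega
          · have := Nat.mul_pos ha hk
            omega
        refine ⟨fun h2 => ?_, !side, _, _, ?_, .main hd fun hh' =>
          hh (.of_step ⟨ρ, hρ, k, rfl, hNk, rfl⟩ hh')⟩
        · have := h2.2
          zify at hd
          omega
        · rw [gamePos_not, h1]
          simp
      · exact ⟨fun h2 => h1 h2.1, !side, _, _, (gamePos_not _ _ _).symm, .cheat h1⟩

/-- The game of an affine rewriting machine is won by Eve iff the machine halts. -/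
theorem eveWins_affine_iff (hφ : Function.Injective φ)
    (hR : ∀ ρ ∈ R, 0 < ρ.a ∧ (0 < ρ.r → 0 < ρ.b)) (s : S) {N : ℕ} (hN : 0 < N) :
    RGSEveWins (affineE R h φ) signalMoves (φ (.main s false), gamePos false N 0) ↔
      AffineHalts R h (s, N) := by
  refine ⟨fun hw => ?_, fun hh => (eveForces_main_of_halts hR hh hN false).eveWins⟩
  by_contra hh
  refine not_eveWins_of_invariant (fun c => c.2.1 % 3 ≠ 0 ∨ ∃ side g u v,
    c = (φ g, gamePos side u v) ∧ Refuted R h side g u v) ?_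
    (.inr ⟨_, _, _, _, rfl, .main hN hh⟩) hw
  have fst (side β u v) : (gameVec side β u v).1 % 3 = (bif β then 2 else 0) := by
    have := gamePos_fst_emod side u v
    cases β <;> simp only [gameVec, signal, Prod.fst_sub, cond_true, cond_false] <;> omega
  rintro ⟨n, x⟩ (hx | ⟨side, g, u, v, hc, hr⟩)
  · refine ⟨signal (decide (x.1 % 3 = 1)), ?_, fun m hm _ => ?_⟩
    · cases decide (x.1 % 3 = 1) <;> simp
    obtain ⟨β, side, g, u, v, g', -, rfl⟩ := mem_affineMoves.1 hm
    have hv := fst side β u v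
    have : (x + signal (decide (x.1 % 3 = 1)) + gameVec side β u v).1 % 3 ≠ 0 := by
      dsimp only at hx
      by_cases h1 : x.1 % 3 = 1 <;> cases β <;>
        simp only [h1, decide_true, decide_false, signal, Prod.fst_add, cond_true,
          cond_false] at hv ⊢ <;> omega
    refine ⟨fun h0 => this ?_, .inl this⟩
    dsimp only at h0
    rw [h0]
    rfl
  · cases hc
    obtain ⟨β, hβ⟩ := hr.exists_signal hR
    refine ⟨signal β, by cases β <;> simp, fun m hm hsrc => ?_⟩
    obtain ⟨β', side', g₀, u', v', g', hmv, rfl⟩ := mem_affineMoves.1 hm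
    obtain rfl := hφ hsrc
    obtain rfl := hmv.side_unique hr
    dsimp only
    by_cases hββ : β' = β
    · subst hββ
      obtain ⟨hne, side₁, u₁, v₁, heq, hr₁⟩ := hβ _ _ _ hmv
      rw [gamePos_add_signal_add_gameVec]
      exact ⟨fun h0 => hne (gamePos_eq_zero.1 h0), .inr ⟨_, _, _, _, by rw [heq], hr₁⟩⟩
    · have : (gamePos side' u v + signal β + gameVec side' β' u' v').1 % 3 ≠ 0 := by
        have h1 := fst side' β' u' v'
        have h2 := gamePos_fst_emod side' u v
        cases β <;> cases β' <;>
          simp only [signal, Prod.fst_add, cond_true, cond_false, not_true, reduceCtorEq,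
            not_false_eq_true] at * <;> omega
      exact ⟨fun h0 => this (by rw [h0]; rfl), .inl this⟩

end Game

/-! ### Loop programs on registers -/

/-- Programs acting on registers `ℕ → ℕ`. The command `loop i p` runs `p` as long as
register `i` is nonzero, decrementing it before each run. -/
inductive RegProg : Type
  | skip
  | inc (i : ℕ)
  | seq (p q : RegProg)
  | loop (i : ℕ) (p : RegProg)
  deriving Countable

namespace RegProg

open Function (update)

/-- `Exec p s t`: the program `p` started with register contents `s` halts with contents `t`. -/
inductive Exec : RegProg → (ℕ → ℕ) → (ℕ → ℕ) → Prop
  | skip (s) : Exec skip s s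
  | inc (i s) : Exec (inc i) s (update s i (s i + 1))
  | seq {p q s t u} : Exec p s t → Exec q t u → Exec (seq p q) s u
  | loop_zero {i p s} : s i = 0 → Exec (loop i p) s s
  | loop_succ {i p s t u n} : s i = n + 1 → Exec p (update s i n) t → Exec (loop i p) t u →
      Exec (loop i p) s u

theorem Exec.congr_right {p : RegProg} {s t u : ℕ → ℕ} (h : Exec p s t) (e : t = u) :
    Exec p s u :=
  e ▸ h

theorem Exec.unique {p : RegProg} {s t u : ℕ → ℕ} (h : Exec p s t) (h' : Exec p s u) :
    t = u := by
  induction h generalizing u with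
  | skip => cases h'; rfl
  | inc => cases h'; rfl
  | seq _ _ ih₁ ih₂ =>
    cases h' with
    | seq h₁ h₂ =>
      obtain rfl := ih₁ h₁
      exact ih₂ h₂
  | loop_zero h0 =>
    cases h' with
    | loop_zero => rfl
    | loop_succ h1 => omega
  | loop_succ h1 _ _ ih₁ ih₂ =>
    cases h' with
    | loop_zero h0 => omega
    | loop_succ h1' h₁ h₂ =>
      obtain rfl : _ = _ := Nat.succ.inj (h1.symm.trans h1')
      obtain rfl := ih₁ h₁
      exact ih₂ h₂

/-- Reset register `i` to zero. -/
def clear (i : ℕ) : RegProg := loop i skip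

theorem exec_clear (i : ℕ) (s : ℕ → ℕ) : Exec (clear i) s (update s i 0) := by
  generalize hn : s i = n
  induction n generalizing s with
  | zero =>
    rw [← hn, Function.update_eq_self]
    exact .loop_zero hn
  | succ n ih =>
    refine .loop_succ hn (.skip _) ?_
    exact (ih _ (by simp)).congr_right (by simp)

/-- Add the contents of register `i` to register `j`, resetting register `i`. -/
def move (i j : ℕ) : RegProg := loop i (inc j)

theorem exec_move {i j : ℕ} (hij : i ≠ j) (s : ℕ → ℕ) :
    Exec (move i j) s (update (update s i 0) j (s j + s i)) := by
  generalize hn : s i = n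
  induction n generalizing s with
  | zero =>
    have : update (update s i 0) j (s j + 0) = s := by
      rw [← hn, Function.update_eq_self, hn, add_zero, Function.update_eq_self]
    rw [this]
    exact .loop_zero hn
  | succ n ih =>
    refine .loop_succ hn (.inc _ _) ?_
    refine (ih _ (by simp [hij])).congr_right ?_
    funext l
    by_cases hj : l = j <;> by_cases hi : l = i <;> simp_all [Function.update_apply]
    omega

/-- Add the contents of register `i` to register `j`, using the auxiliary register `t`. -/
def copy (i j t : ℕ) : RegProg := seq (move i t) (loop t (seq (inc i) (inc j)))

theorem exec_copy {i j t : ℕ} (hij : i ≠ j) (hit : i ≠ t) (hjt : j ≠ t) {s : ℕ → ℕ}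
    (ht : s t = 0) : Exec (copy i j t) s (update s j (s j + s i)) := by
  have back (n : ℕ) (u : ℕ → ℕ) (hn : u t = n) : Exec (loop t (seq (inc i) (inc j))) u
      (update (update (update u t 0) i (u i + n)) j (u j + n)) := by
    induction n generalizing u with
    | zero =>
      refine (Exec.loop_zero hn).congr_right ?_
      funext l
      by_cases hj : l = j <;> by_cases hi : l = i <;> by_cases ht' : l = t <;>
        simp_all
    | succ n ih =>
      refine .loop_succ hn (.seq (.inc _ _) (.inc _ _)) ?_
      refine (ih _ (by simp [hit.symm, hjt.symm])).congr_right ?_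
      funext l
      by_cases hj : l = j <;> by_cases hi : l = i <;> by_cases ht' : l = t <;>
        simp_all [Function.update_apply] <;> omega
  refine (Exec.seq (exec_move hit s) (back (s i) _ (by simp [ht]))).congr_right ?_
  funext l
  by_cases hj : l = j <;> by_cases hi : l = i <;> by_cases ht' : l = t <;>
    simp_all [Function.update_apply]

/-- For all input registers `ins` and each output register `out` below `base`, there is a program
adding the value of `f` to `out`, provided all registers from `base` on are zero. -/
def Implementable {n : ℕ} (f : List.Vector ℕ n → ℕ) : Prop :=
  ∀ (ins : Fin n → ℕ) (out base : ℕ), (∀ i, ins i < base) → out < base → (∀ i, ins i ≠ out) →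
    ∃ p, ∀ s : ℕ → ℕ, (∀ j, base ≤ j → s j = 0) →
      Exec p s (update s out (s out + f (List.Vector.ofFn fun i => s (ins i))))

theorem implementable_comp {m n : ℕ} {f : List.Vector ℕ n → ℕ} (hf : Implementable f)
    {g : Fin n → List.Vector ℕ m → ℕ} (hg : ∀ i, Implementable (g i)) :
    Implementable fun a => f (List.Vector.ofFn fun i => g i a) := by
  intro ins out base hins hout hne
  let val (s : ℕ → ℕ) (i : Fin n) : ℕ := g i (List.Vector.ofFn fun i => s (ins i))
  let mid (s : ℕ → ℕ) (k : ℕ) (j : ℕ) : ℕ :=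
    if h : base ≤ j ∧ j - base < n then if j - base < k then val s ⟨j - base, h.2⟩ else s j
    else s j
  have fill (k : ℕ) (hk : k ≤ n) : ∃ p, ∀ s : ℕ → ℕ, (∀ j, base ≤ j → s j = 0) →
      Exec p s (mid s k) := by
    induction k with
    | zero =>
      refine ⟨skip, fun s _ => ?_⟩
      convert Exec.skip s using 1
      funext j
      simp [mid]
    | succ k ih =>
      obtain ⟨p, hp⟩ := ih (by omega)
      obtain ⟨q, hq⟩ := hg ⟨k, by omega⟩ ins (base + k) (base + n)
        (fun i => (hins i).trans_le (by omega)) (by omega) (fun i => by have := hins i; omega)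
      refine ⟨seq p q, fun s hs => ?_⟩
      convert Exec.seq (hp s hs) (hq (mid s k) fun j hj => ?_) using 1
      · have hin (i : Fin m) : mid s k (ins i) = s (ins i) := by
          have := hins i
          exact dif_neg (by omega)
        have hval : mid s k (base + k) = 0 := by
          simp [mid, hs]
        rw [hval]
        simp only [hin]
        funext j
        by_cases hj : j = base + k
        · subst hj
          have : k < n := by omega
          simp [mid, val, this]
        · rw [Function.update_of_ne hj]
          simp only [mid]
          split_ifs <;> first | rfl | omega
      · simp only [mid]
        rw [dif_neg (by omega)]
        exact hs j (by omega)
  have clean (k : ℕ) : ∃ p, ∀ s : ℕ → ℕ,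
      Exec p s (fun j => if base ≤ j ∧ j < base + k then 0 else s j) := by
    induction k with
    | zero =>
      refine ⟨skip, fun s => ?_⟩
      convert Exec.skip s using 1
      funext j
      exact if_neg (by omega)
    | succ k ih =>
      obtain ⟨p, hp⟩ := ih
      refine ⟨seq p (clear (base + k)), fun s => ?_⟩
      convert Exec.seq (hp s) (exec_clear _ _) using 1
      funext j
      by_cases hj : j = base + k
      · simp [hj]
      · rw [Function.update_of_ne hj]
        split_ifs <;> first | rfl | omega
  obtain ⟨p, hp⟩ := fill n le_rfl
  obtain ⟨q, hq⟩ := hf (fun i => base + i) out (base + n) (fun i => by omega) (by omega)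
    (fun i => by omega)
  obtain ⟨r, hr⟩ := clean n
  refine ⟨seq p (seq q r), fun s hs => ?_⟩
  convert Exec.seq (hp s hs) (.seq (hq (mid s n) fun j hj => ?_) (hr _)) using 1
  · have hmid (i : Fin n) : mid s n (base + i) = val s i := by simp [mid]
    have hmid_out : mid s n out = s out := dif_neg (by omega)
    simp only [hmid, hmid_out]
    funext j
    by_cases hj : j = out
    · subst hj
      rw [if_neg (by omega)]
      simp [val]
    · rw [Function.update_of_ne hj, Function.update_of_ne hj]
      simp only [mid]
      split_ifs <;> first | rfl | omega | exact hs j (by omega)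
  · simp only [mid]
    rw [dif_neg (by omega)]
    exact hs j (by omega)

theorem implementable_prec {n : ℕ} {f : List.Vector ℕ n → ℕ} (hf : Implementable f)
    {g : List.Vector ℕ (n + 2) → ℕ} (hg : Implementable g) :
    Implementable fun v : List.Vector ℕ (n + 1) =>
      v.head.rec (f v.tail) fun y IH => g (y ::ᵥ IH ::ᵥ v.tail) := by
  intro ins out base hins hout hne
  -- `base`: remaining iterations, `base + 1`: index, `base + 2`: value, `base + 3`: next value
  obtain ⟨pf, hpf⟩ := hf (fun i => ins i.succ) (base + 2) (base + 4)
    (fun i => (hins _).trans (by omega)) (by omega) (fun i => by have := hins i.succ; omega)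
  obtain ⟨pg, hpg⟩ := hg (Fin.cons (base + 1) (Fin.cons (base + 2) fun i => ins i.succ))
    (base + 3) (base + 4)
    (fun i => by
      refine Fin.cases (by simp) (fun i => ?_) i
      refine Fin.cases (by simp) (fun i => ?_) i
      exact (hins _).trans (by omega))
    (by omega)
    (fun i => by
      refine Fin.cases (by simp) (fun i => ?_) i
      refine Fin.cases (by simp) (fun i => ?_) i
      have := hins i.succ
      simp only [Fin.cons_succ]
      omega)
  let rest (s : ℕ → ℕ) : List.Vector ℕ n := List.Vector.ofFn fun i => s (ins i.succ)
  let iter (s : ℕ → ℕ) (k : ℕ) : ℕ := k.rec (f (rest s)) fun y IH => g (y ::ᵥ IH ::ᵥ rest s)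
  let st (s : ℕ → ℕ) (c k : ℕ) : ℕ → ℕ :=
    update (update (update s base c) (base + 1) k) (base + 2) (iter s k)
  let body : RegProg :=
    seq pg (seq (clear (base + 2)) (seq (move (base + 3) (base + 2)) (inc (base + 1))))
  have hbody (s : ℕ → ℕ) (hs : ∀ j, base ≤ j → s j = 0) (c k : ℕ) :
      Exec body (st s c k) (st s c (k + 1)) := by
    have hz (j : ℕ) (hj : base + 4 ≤ j) : st s c k j = 0 := by
      simp only [st]
      rw [Function.update_of_ne (by omega), Function.update_of_ne (by omega),
        Function.update_of_ne (by omega)]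
      exact hs j (by omega)
    refine (Exec.seq (hpg _ hz) (.seq (exec_clear _ _)
      (.seq (exec_move (by omega) _) (.inc _ _)))).congr_right ?_
    · have harg : (List.Vector.ofFn fun i => st s c k
          ((Fin.cons (base + 1) (Fin.cons (base + 2) fun i => ins i.succ) : Fin (n + 2) → ℕ) i)) =
          k ::ᵥ iter s k ::ᵥ rest s := by
        simp only [List.Vector.ofFn, Fin.cons_zero, Fin.cons_succ]
        congr 1
        · simp [st]
        congr 1
        · simp [st]
        · refine congrArg _ (funext fun i => ?_)
          have := hins i.succ
          simp only [st]
          rw [Function.update_of_ne (by omega), Function.update_of_ne (by omega),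
            Function.update_of_ne (by omega)]
      rw [harg]
      have h3 := hs (base + 3) (by omega)
      funext j
      by_cases h0 : j = base
      · simp [h0, st]
      by_cases h1 : j = base + 1
      · simp [h1, st]
      by_cases h2 : j = base + 2
      · simp [h2, st, iter, h3]
      by_cases h3' : j = base + 3
      · simp [h3', st, h3]
      simp [st, h0, h1, h2, h3']
  have hloop (s : ℕ → ℕ) (hs : ∀ j, base ≤ j → s j = 0) (c k : ℕ) :
      Exec (loop base body) (st s c k) (st s 0 (k + c)) := by
    induction c generalizing k with
    | zero => exact .loop_zero (by simp [st])
    | succ c ih =>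
      refine .loop_succ (n := c) (by simp [st]) ?_
        (by rw [← add_assoc, add_right_comm]; exact ih (k + 1))
      convert hbody s hs c k using 1
      funext j
      by_cases h0 : j = base
      · simp [h0, st]
      · simp [st, h0, Function.update_apply]
  refine ⟨seq (copy (ins 0) base (base + 1)) (seq pf (seq (loop base body)
    (seq (move (base + 2) out) (clear (base + 1))))), fun s hs => ?_⟩
  have h0 := hins 0
  refine .seq (exec_copy (by omega) (by omega) (by omega) (hs _ (by omega))) ?_
  rw [hs base le_rfl, zero_add]
  refine .seq (t := st s (s (ins 0)) 0) ?_ (.seq (hloop s hs _ 0) ?_)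
  · convert hpf _ fun j hj => ?_ using 1
    · have hrest : (List.Vector.ofFn fun i : Fin n =>
          update s base (s (ins 0)) (ins i.succ)) = rest s := by
        refine congrArg _ (funext fun i => ?_)
        have := hins i.succ
        rw [Function.update_of_ne (by omega)]
      rw [hrest]
      have h1 := hs (base + 1) (by omega)
      have h2 := hs (base + 2) (by omega)
      simp only [st, iter]
      rw [Function.update_of_ne (a := base + 2) (by omega), h2, zero_add]
      congr 1
      refine Function.update_eq_self_iff.2 ?_
      rw [Function.update_of_ne (by omega), h1]
    · rw [Function.update_of_ne (by omega)]
      exact hs j (by omega)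
  · refine (Exec.seq (exec_move (by omega) _) (exec_clear _ _)).congr_right ?_
    have hhead : (List.Vector.ofFn fun i => s (ins i)).head = s (ins 0) := rfl
    have htail : (List.Vector.ofFn fun i => s (ins i)).tail = rest s := by
      simp [List.Vector.ofFn, rest]
    beta_reduce
    rw [hhead, htail]
    funext j
    by_cases hj : j = out
    · subst hj
      simp [st, iter, show j ≠ base + 1 by omega,
        show j ≠ base + 2 by omega, show j ≠ base by omega]
    · by_cases hb : base ≤ j
      · by_cases h1 : j = base
        · simp [h1, st, hs, Function.update_apply, hout.ne']
        by_cases h1' : j = base + 1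
        · simp [h1', hs, (show base + 1 ≠ out by omega)]
        by_cases h2 : j = base + 2
        · simp [h2, hs, (show base + 2 ≠ out by omega)]
        simp [st, h1, h1', h2, hj, Function.update_apply]
      · simp [st, hj, Function.update_apply, show j ≠ base + 1 by omega,
          show j ≠ base + 2 by omega, show j ≠ base by omega]

theorem implementable_of_primrec' {n : ℕ} {f : List.Vector ℕ n → ℕ} (hf : Nat.Primrec' f) :
    Implementable f := by
  induction hf with
  | zero =>
    intro ins out base _ _ _
    exact ⟨skip, fun s _ => by simpa using Exec.skip s⟩
  | succ =>
    intro ins out base hins hout hne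
    have := hins 0
    refine ⟨seq (copy (ins 0) out base) (inc out), fun s hs => ?_⟩
    convert Exec.seq (exec_copy (hne 0) (by omega) (by omega) (hs base le_rfl)) (.inc _ _) using 1
    simp [List.Vector.ofFn, add_assoc]
  | get i =>
    intro ins out base hins hout hne
    have := hins i
    refine ⟨copy (ins i) out base, fun s hs => ?_⟩
    simpa using exec_copy (hne i) (by omega) (by omega) (hs base le_rfl)
  | comp g _ _ hf hg => exact implementable_comp hf hg
  | prec _ _ hf hg => exact implementable_prec hf hg

/-- For a primitive recursive `g` there is a program that halts on the input `x` in register `0`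
iff `g x k = 0` for some `k`. -/
theorem exists_search {g : ℕ → ℕ → ℕ} (hg : Primrec₂ g) :
    ∃ p : RegProg, ∀ x, (∃ t, Exec p (update 0 0 x) t) ↔ ∃ k, g x k = 0 := by
  -- `0`: input, `1`: candidate, `2`: value, `3`: flag
  obtain ⟨pg, hpg⟩ := implementable_of_primrec' (Nat.Primrec'.prim_iff₂.2 hg) ![0, 1] 2 4
    (fun i => by fin_cases i <;> simp) (by omega) (fun i => by fin_cases i <;> simp)
  let body : RegProg := seq pg (seq (loop 2 (seq (clear 2) (inc 3))) (inc 1))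
  let st (x k z : ℕ) : ℕ → ℕ := update (update (update 0 0 x) 1 k) 3 z
  have hbody (x k : ℕ) :
      Exec body (st x k 0) (st x (k + 1) (if g x k = 0 then 0 else 1)) := by
    have h1 := hpg (st x k 0) fun j hj => by
      simp [st, show j ≠ 0 by omega, show j ≠ 1 by omega,
        show j ≠ 3 by omega]
    have h2 : st x k 0 2 + g x k = g x k := by simp [st]
    simp only [List.Vector.ofFn, List.Vector.head_cons, List.Vector.tail_cons] at h1
    replace h1 : Exec pg (st x k 0) (update (st x k 0) 2 (g x k)) := by
      convert h1 using 2
      simp [st]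
    refine .seq h1 (.seq (t := st x k (if g x k = 0 then 0 else 1)) ?_ ?_)
    · split_ifs with h0
      · have : update (st x k 0) 2 (g x k) = st x k 0 := by
          rw [Function.update_eq_self_iff]
          simp [st, h0]
        rw [this]
        exact .loop_zero (by simp [st])
      · obtain ⟨m, hm⟩ := Nat.exists_eq_succ_of_ne_zero h0
        refine .loop_succ (n := m) (by simp [hm]) (.seq (exec_clear _ _) (.inc _ _)) ?_
        convert Exec.loop_zero _ using 1
        · funext j
          by_cases h3 : j = 3
          · simp [h3, st]
          by_cases h2 : j = 2
          · simp [h2, st]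
          simp [st, h2, h3]
        · simp [st]
    · convert Exec.inc _ _ using 1
      funext j
      by_cases h1 : j = 1 <;> simp [st, h1, Function.update_apply]
  have hst (x k : ℕ) : update (st x k 1) 3 0 = st x k 0 := by simp [st]
  refine ⟨seq (inc 3) (loop 3 body), fun x => ?_⟩
  have hstart : update (update (0 : ℕ → ℕ) 0 x) 3 (update (0 : ℕ → ℕ) 0 x 3 + 1) = st x 0 1 := by
    have : update (update (0 : ℕ → ℕ) 0 x) 1 0 = update (0 : ℕ → ℕ) 0 x := by simp
    simp [st, this]
  constructor
  · rintro ⟨t, ht⟩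
    cases ht with
    | seq h1 h2 =>
      cases h1
      rw [hstart] at h2
      have key {p s t} (h : Exec p s t) (k : ℕ) (hp : loop 3 body = p) (hs : st x k 1 = s) :
          ∃ k, g x k = 0 := ?_
      · exact key h2 0 rfl rfl
      induction h generalizing k with
      | skip | inc | seq => cases hp
      | loop_zero h0 =>
        cases hp
        subst hs
        simp [st] at h0
      | loop_succ h1 h2 _ _ ih =>
        cases hp
        subst hs
        obtain rfl : _ = 0 := by simpa [st, eq_comm] using h1
        rw [hst] at h2
        by_cases h0 : g x k = 0
        · exact ⟨k, h0⟩
        · have := (hbody x k).unique h2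
          rw [if_neg h0] at this
          exact ih (k + 1) rfl this
  · rintro ⟨k, hk⟩
    suffices H : ∀ d j, j + d = k → ∃ t, Exec (loop 3 body) (st x j 1) t by
      obtain ⟨t, ht⟩ := H k 0 (zero_add k)
      rw [← hstart] at ht
      exact ⟨t, .seq (.inc _ _) ht⟩
    intro d
    induction d with
    | zero =>
      rintro j rfl
      refine ⟨_, .loop_succ (n := 0) (by simp [st]) ?_ (.loop_zero (s := st x (j + 1) 0) ?_)⟩
      · rw [hst]
        simpa [show g x j = 0 from hk] using hbody x j
      · simp [st]
    | succ d ih =>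
      intro j hj
      have hb := hbody x j
      by_cases h0 : g x j = 0
      · rw [if_pos h0] at hb
        rw [← hst] at hb
        exact ⟨_, .loop_succ (n := 0) (by simp [st]) hb (.loop_zero (by simp [st]))⟩
      · rw [if_neg h0, ← hst] at hb
        obtain ⟨t, ht⟩ := ih (j + 1) (by omega)
        exact ⟨t, .loop_succ (n := 0) (by simp [st]) hb ht⟩

/-- There is a program for which halting on a given input is as hard as the halting problem. -/
theorem exists_universal : ∃ p : RegProg, ∀ c : Nat.Partrec.Code,
    (∃ t, Exec p (update 0 0 (Encodable.encode c)) t) ↔ (c.eval 0).Dom := by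
  have hg : Primrec₂ fun x k : ℕ => Encodable.encode
      (!(Nat.Partrec.Code.evaln k (Denumerable.ofNat Nat.Partrec.Code x) 0).isSome) :=
    Primrec.encode.comp <| Primrec.not.comp <| Primrec.option_isSome.comp <|
      Nat.Partrec.Code.primrec_evaln.comp <| Primrec.pair
        (Primrec.pair .snd ((Primrec.ofNat _).comp .fst)) (.const 0)
  obtain ⟨p, hp⟩ := exists_search hg
  refine ⟨p, fun c => (hp _).trans ?_⟩
  simp only [Denumerable.ofNat_encode, Part.dom_iff_mem, Nat.Partrec.Code.evaln_complete]
  rw [exists_comm]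
  refine exists_congr fun k => ?_
  rcases h : Nat.Partrec.Code.evaln k c 0 <;> simp

end RegProg

/-! ### Loop programs as affine rewriting machines -/

namespace RegProg

open Function (update)

/-- The code of the first `n` registers as a product of prime powers. -/
noncomputable def registerCode (n : ℕ) (s : ℕ → ℕ) : ℕ :=
  ∏ i ∈ Finset.range n, Nat.nth Nat.Prime i ^ s i

theorem registerCode_pos (n : ℕ) (s : ℕ → ℕ) : 0 < registerCode n s :=
  Finset.prod_pos fun i _ => pow_pos (Nat.prime_nth_prime i).pos _

theorem registerCode_eq_pow_mul {n i : ℕ} (hi : i < n) (s : ℕ → ℕ) :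
    registerCode n s = Nat.nth Nat.Prime i ^ s i *
      ∏ j ∈ (Finset.range n).erase i, Nat.nth Nat.Prime j ^ s j :=
  (Finset.mul_prod_erase _ _ (Finset.mem_range.2 hi)).symm

theorem registerCode_update {n i : ℕ} (hi : i < n) (s : ℕ → ℕ) (v : ℕ) :
    registerCode n (update s i v) = Nat.nth Nat.Prime i ^ v *
      ∏ j ∈ (Finset.range n).erase i, Nat.nth Nat.Prime j ^ s j := by
  rw [registerCode_eq_pow_mul hi, Function.update_self]
  congr 1
  refine Finset.prod_congr rfl fun j hj => ?_
  rw [Function.update_of_ne (Finset.ne_of_mem_erase hj)]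

theorem registerCode_inc {n i : ℕ} (hi : i < n) (s : ℕ → ℕ) :
    registerCode n (update s i (s i + 1)) = Nat.nth Nat.Prime i * registerCode n s := by
  rw [registerCode_update hi, registerCode_eq_pow_mul hi s, pow_succ']
  ring

theorem registerCode_dec {n i k : ℕ} (hi : i < n) {s : ℕ → ℕ} (hs : s i = k + 1) :
    registerCode n s = Nat.nth Nat.Prime i * registerCode n (update s i k) := by
  rw [registerCode_update hi, registerCode_eq_pow_mul hi s, hs, pow_succ']
  ring

theorem not_dvd_registerCode {n i : ℕ} (hi : i < n) {s : ℕ → ℕ} (hs : s i = 0) :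
    ¬ Nat.nth Nat.Prime i ∣ registerCode n s := by
  rw [registerCode_eq_pow_mul hi, hs, pow_zero, one_mul]
  refine (Nat.Prime.coprime_iff_not_dvd (Nat.prime_nth_prime i)).1 ?_
  refine Nat.Coprime.prod_right fun j hj => Nat.Coprime.pow_right _ ?_
  rw [Nat.coprime_primes (Nat.prime_nth_prime i) (Nat.prime_nth_prime j)]
  exact fun h => Finset.ne_of_mem_erase hj
    (Nat.nth_injective Nat.infinite_setOfPred_prime h).symm

/-- Small-step semantics: a configuration consists of the programs that remain to be run and the
register contents. -/
inductive Step : List RegProg × (ℕ → ℕ) → List RegProg × (ℕ → ℕ) → Prop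
  | skip (K s) : Step (skip :: K, s) (K, s)
  | inc (i K s) : Step (inc i :: K, s) (K, update s i (s i + 1))
  | seq (p q K s) : Step (seq p q :: K, s) (p :: q :: K, s)
  | loop_zero {i s} (p K) : s i = 0 → Step (loop i p :: K, s) (K, s)
  | loop_succ {i s n} (p K) : s i = n + 1 →
      Step (loop i p :: K, s) (p :: loop i p :: K, update s i n)

theorem Exec.reflTransGen_step {p : RegProg} {s t : ℕ → ℕ} (h : Exec p s t)
    (K : List RegProg) : Relation.ReflTransGen Step (p :: K, s) (K, t) := by
  induction h generalizing K with
  | skip => exact .single (.skip _ _)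
  | inc => exact .single (.inc _ _ _)
  | seq _ _ ih₁ ih₂ => exact .head (.seq _ _ _ _) ((ih₁ _).trans (ih₂ _))
  | loop_zero h => exact .single (.loop_zero _ _ h)
  | loop_succ h _ _ ih₁ ih₂ => exact .head (.loop_succ _ _ h) ((ih₁ _).trans (ih₂ _))

/-- Consecutive execution of a list of programs. -/
inductive ExecList : List RegProg → (ℕ → ℕ) → (ℕ → ℕ) → Prop
  | nil (s) : ExecList [] s s
  | cons {p K s t u} : Exec p s t → ExecList K t u → ExecList (p :: K) s u

theorem execList_of_reflTransGen {c : List RegProg × (ℕ → ℕ)} {t : ℕ → ℕ}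
    (h : Relation.ReflTransGen Step c ([], t)) : ExecList c.1 c.2 t := by
  induction h using Relation.ReflTransGen.head_induction_on with
  | refl => exact .nil _
  | head hstep _ ih =>
    cases hstep with
    | skip => exact .cons (.skip _) ih
    | inc => exact .cons (.inc _ _) ih
    | seq =>
      rcases ih with _ | ⟨h₁, _ | ⟨h₂, h₃⟩⟩
      exact .cons (.seq h₁ h₂) h₃
    | loop_zero _ _ h => exact .cons (.loop_zero h) ih
    | loop_succ _ _ h =>
      rcases ih with _ | ⟨h₁, _ | ⟨h₂, h₃⟩⟩
      exact .cons (.loop_succ h h₁ h₂) h₃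

theorem exec_iff_reflTransGen {p : RegProg} {s t : ℕ → ℕ} :
    Exec p s t ↔ Relation.ReflTransGen Step ([p], s) ([], t) := by
  refine ⟨fun h => h.reflTransGen_step [], fun h => ?_⟩
  rcases execList_of_reflTransGen h with _ | ⟨h₁, h₂⟩
  cases h₂
  exact h₁

/-- A bound on the registers used by a program. -/
def bound : RegProg → ℕ
  | skip => 0
  | inc i => i + 1
  | seq p q => max p.bound q.bound
  | loop i p => max (i + 1) p.bound

/-- The control points passed while running `p` with continuation `K`, except for `K` itself. -/
def controlPoints : RegProg → List RegProg → List (List RegProg)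
  | skip, K => [skip :: K]
  | inc i, K => [inc i :: K]
  | seq p q, K => (seq p q :: K) :: (p.controlPoints (q :: K) ++ q.controlPoints K)
  | loop i p, K => (loop i p :: K) :: p.controlPoints (loop i p :: K)

theorem cons_mem_controlPoints (p : RegProg) (K : List RegProg) :
    p :: K ∈ p.controlPoints K := by
  cases p <;> simp [controlPoints]

theorem Step.mem_controlPoints {p : RegProg} {K L L' : List RegProg} {s s' : ℕ → ℕ}
    (h : Step (L, s) (L', s')) (hL : L ∈ p.controlPoints K) :
    L' ∈ p.controlPoints K ∨ L' = K := by
  induction p generalizing K with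
  | skip | inc =>
    simp only [controlPoints, List.mem_singleton] at hL
    subst hL
    cases h
    exact .inr rfl
  | seq p q ihp ihq =>
    simp only [controlPoints, List.mem_cons, List.mem_append] at hL ⊢
    rcases hL with rfl | hL | hL
    · cases h
      exact .inl (.inr (.inl (cons_mem_controlPoints _ _)))
    · rcases ihp hL with h' | rfl
      · exact .inl (.inr (.inl h'))
      · exact .inl (.inr (.inr (cons_mem_controlPoints _ _)))
    · exact (ihq hL).imp (fun h' => .inr (.inr h')) id
  | loop i p ih =>
    simp only [controlPoints, List.mem_cons] at hL ⊢
    rcases hL with rfl | hL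
    · cases h with
      | loop_zero => exact .inr rfl
      | loop_succ => exact .inl (.inr (cons_mem_controlPoints _ _))
    · exact .inl (ih hL).symm

theorem bound_le_of_mem_controlPoints {n : ℕ} {p : RegProg} {K L : List RegProg}
    (hp : p.bound ≤ n) (hK : ∀ q ∈ K, q.bound ≤ n) (hL : L ∈ p.controlPoints K) :
    ∀ q ∈ L, q.bound ≤ n := by
  induction p generalizing K with
  | skip | inc =>
    simp only [controlPoints, List.mem_singleton] at hL
    subst hL
    exact List.forall_mem_cons.2 ⟨hp, hK⟩
  | seq p q ihp ihq =>
    have hp' := hp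
    simp only [bound, max_le_iff] at hp'
    simp only [controlPoints, List.mem_cons, List.mem_append] at hL
    rcases hL with rfl | hL | hL
    · exact List.forall_mem_cons.2 ⟨hp, hK⟩
    · exact ihp hp'.1 (List.forall_mem_cons.2 ⟨hp'.2, hK⟩) hL
    · exact ihq hp'.2 hK hL
  | loop i p ih =>
    have hp' := hp
    simp only [bound, max_le_iff] at hp'
    simp only [controlPoints, List.mem_cons] at hL
    rcases hL with rfl | hL
    · exact List.forall_mem_cons.2 ⟨hp, hK⟩
    · exact ih hp'.2 (List.forall_mem_cons.2 ⟨hp, hK⟩) hL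

/-- The affine rules simulating the small steps from a control point. -/
noncomputable def stepRules : List RegProg → List (AffineRule (List RegProg))
  | [] => []
  | skip :: K => [⟨skip :: K, 1, 0, 1, 0, K⟩]
  | inc i :: K => [⟨inc i :: K, 1, 0, Nat.nth Nat.Prime i, 0, K⟩]
  | seq p q :: K => [⟨seq p q :: K, 1, 0, 1, 0, p :: q :: K⟩]
  | loop i p :: K => ⟨loop i p :: K, Nat.nth Nat.Prime i, 0, 1, 0, p :: loop i p :: K⟩ ::
      (List.range (Nat.nth Nat.Prime i - 1)).map fun r =>
        ⟨loop i p :: K, Nat.nth Nat.Prime i, r + 1, Nat.nth Nat.Prime i, r + 1, K⟩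

/-- The affine rules simulating a program. -/
noncomputable def rules (p : RegProg) : List (AffineRule (List RegProg)) :=
  (p.controlPoints []).flatMap stepRules

theorem stepRules_pos {L : List RegProg} {ρ : AffineRule (List RegProg)}
    (hρ : ρ ∈ stepRules L) : 0 < ρ.a ∧ (0 < ρ.r → 0 < ρ.b) := by
  match L with
  | [] | skip :: K | seq p q :: K => simp_all [stepRules]
  | inc i :: K =>
    simp only [stepRules, List.mem_singleton] at hρ
    subst hρ
    exact ⟨(Nat.prime_nth_prime i).pos, id⟩
  | loop i p :: K =>
    simp only [stepRules, List.mem_cons, List.mem_map] at hρ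
    obtain rfl | ⟨r, -, rfl⟩ := hρ
    · exact ⟨one_pos, id⟩
    · exact ⟨(Nat.prime_nth_prime i).pos, id⟩

theorem src_eq_of_mem_stepRules {L : List RegProg} {ρ : AffineRule (List RegProg)}
    (hρ : ρ ∈ stepRules L) : ρ.src = L := by
  match L with
  | [] | skip :: K | seq p q :: K | inc i :: K => simp_all [stepRules]
  | loop i p :: K =>
    simp only [stepRules, List.mem_cons, List.mem_map] at hρ
    obtain rfl | ⟨r, -, rfl⟩ := hρ <;> rfl

theorem affineStep_stepRules_of_step {n : ℕ} {L L' : List RegProg} {s s' : ℕ → ℕ}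
    (hL : ∀ q ∈ L, q.bound ≤ n) (h : Step (L, s) (L', s')) :
    AffineStep (stepRules L) (L, registerCode n s) (L', registerCode n s') := by
  cases h with
  | skip | seq => exact ⟨_, List.mem_singleton_self _, registerCode n s, rfl, by simp, by simp⟩
  | inc i =>
    have hi : i < n := hL (inc i) List.mem_cons_self
    exact ⟨_, List.mem_singleton_self _, registerCode n s, rfl, by simp,
      by simp [registerCode_inc hi]⟩
  | @loop_zero i _ p K h0 =>
    have hi : i < n := (le_max_left _ _).trans (hL (loop i p) List.mem_cons_self)
    have hmod : registerCode n s % Nat.nth Nat.Prime i ≠ 0 := fun h =>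
      not_dvd_registerCode hi h0 (Nat.dvd_of_mod_eq_zero h)
    have hlt := Nat.mod_lt (registerCode n s) (Nat.prime_nth_prime i).pos
    have hdiv := Nat.div_add_mod (registerCode n s) (Nat.nth Nat.Prime i)
    obtain ⟨r, hr⟩ := Nat.exists_eq_succ_of_ne_zero hmod
    refine ⟨_, List.mem_cons_of_mem _ (List.mem_map.2 ⟨r, List.mem_range.2 (by omega), rfl⟩),
      registerCode n s / Nat.nth Nat.Prime i, rfl, ?_, ?_⟩
    · simp only
      omega
    · simp only [Prod.mk.injEq, true_and]
      omega
  | @loop_succ i _ k p K hk =>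
    have hi : i < n := (le_max_left _ _).trans (hL (loop i p) List.mem_cons_self)
    exact ⟨_, List.mem_cons_self, registerCode n (update s i k), rfl,
      by simpa using registerCode_dec hi hk, by simp⟩

theorem exists_step_of_affineStep_stepRules {n : ℕ} {L : List RegProg} {s : ℕ → ℕ}
    {d : List RegProg × ℕ} (hL : ∀ q ∈ L, q.bound ≤ n)
    (h : AffineStep (stepRules L) (L, registerCode n s) d) :
    ∃ s', Step (L, s) (d.1, s') ∧ d.2 = registerCode n s' := by
  obtain ⟨ρ, hρ, k, -, hk, rfl⟩ := h
  match L with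
  | [] => simp [stepRules] at hρ
  | skip :: K =>
    simp only [stepRules, List.mem_singleton] at hρ
    subst hρ
    exact ⟨s, .skip _ _, by simpa using hk.symm⟩
  | seq p q :: K =>
    simp only [stepRules, List.mem_singleton] at hρ
    subst hρ
    exact ⟨s, .seq _ _ _ _, by simpa using hk.symm⟩
  | inc i :: K =>
    have hi : i < n := hL (inc i) List.mem_cons_self
    simp only [stepRules, List.mem_singleton] at hρ
    subst hρ
    exact ⟨_, .inc _ _ _, by simp_all [registerCode_inc hi]⟩
  | loop i p :: K =>
    have hi : i < n := (le_max_left _ _).trans (hL (loop i p) List.mem_cons_self)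
    simp only [stepRules, List.mem_cons, List.mem_map] at hρ
    rcases hs : s i with _ | m
    · obtain rfl | ⟨r, -, rfl⟩ := hρ
      · exact (not_dvd_registerCode hi hs ⟨k, by simpa using hk⟩).elim
      · exact ⟨s, .loop_zero _ _ hs, hk.symm⟩
    · have hdec := registerCode_dec hi hs
      have hpos := (Nat.prime_nth_prime i).pos
      obtain rfl | ⟨r, hr, rfl⟩ := hρ
      · refine ⟨_, .loop_succ _ _ hs, ?_⟩
        have : Nat.nth Nat.Prime i * registerCode n (update s i m) =
            Nat.nth Nat.Prime i * k := by simpa [hdec] using hk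
        simpa using (Nat.eq_of_mul_eq_mul_left hpos this).symm
      · have hdvd : Nat.nth Nat.Prime i ∣ Nat.nth Nat.Prime i * k + (r + 1) :=
          ⟨_, hk.symm.trans hdec⟩
        have := Nat.le_of_dvd (Nat.succ_pos r) ((Nat.dvd_add_right (dvd_mul_right _ _)).1 hdvd)
        have := List.mem_range.1 hr
        omega

theorem affineStep_rules_iff {p : RegProg} {L : List RegProg} {N : ℕ}
    {d : List RegProg × ℕ} :
    AffineStep p.rules (L, N) d ↔ L ∈ p.controlPoints [] ∧ AffineStep (stepRules L) (L, N) d := by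
  constructor
  · rintro ⟨ρ, hρ, k, hsrc, h⟩
    obtain ⟨L', hL', hρ'⟩ := List.mem_flatMap.1 hρ
    obtain rfl : L' = L := (src_eq_of_mem_stepRules hρ').symm.trans hsrc
    exact ⟨hL', ρ, hρ', k, hsrc, h⟩
  · rintro ⟨hL, ρ, hρ, h⟩
    exact ⟨ρ, List.mem_flatMap.2 ⟨L, hL, hρ⟩, h⟩

theorem affineHalts_rules_iff {p : RegProg} {n : ℕ} (hn : p.bound ≤ n) (s : ℕ → ℕ) :
    AffineHalts p.rules [] ([p], registerCode n s) ↔ ∃ t, Exec p s t := by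
  have hbound {L : List RegProg} (hL : L ∈ p.controlPoints []) : ∀ q ∈ L, q.bound ≤ n :=
    bound_le_of_mem_controlPoints hn (by simp) hL
  simp only [exec_iff_reflTransGen]
  constructor
  · have key {c d : List RegProg × ℕ} (h : Relation.ReflTransGen (AffineStep p.rules) c d)
        (s : ℕ → ℕ) (hc : c.2 = registerCode n s) :
        ∃ t, Relation.ReflTransGen Step (c.1, s) (d.1, t) := by
      induction h using Relation.ReflTransGen.head_induction_on generalizing s with
      | refl => exact ⟨s, .refl⟩
      | @head c c' hstep _ ih =>
        obtain ⟨L, N⟩ := c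
        obtain rfl : N = registerCode n s := hc
        obtain ⟨hL, hstep⟩ := affineStep_rules_iff.1 hstep
        obtain ⟨s', hs, hc'⟩ := exists_step_of_affineStep_stepRules (hbound hL) hstep
        exact (ih s' hc').imp fun t ht => .head hs ht
    exact fun ⟨N, hN⟩ => key hN s rfl
  · rintro ⟨t, ht⟩
    have key {c d : List RegProg × (ℕ → ℕ)} (h : Relation.ReflTransGen Step c d)
        (hc : c.1 ∈ p.controlPoints [] ∨ c.1 = []) :
        Relation.ReflTransGen (AffineStep p.rules) (c.1, registerCode n c.2)
          (d.1, registerCode n d.2) := by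
      induction h using Relation.ReflTransGen.head_induction_on with
      | refl => exact .refl
      | @head c c' hstep _ ih =>
        obtain ⟨L, s⟩ := c
        obtain ⟨L', s'⟩ := c'
        rcases hc with hL | rfl
        · exact .head
            (affineStep_rules_iff.2 ⟨hL, affineStep_stepRules_of_step (hbound hL) hstep⟩)
            (ih (hstep.mem_controlPoints hL))
        · cases hstep
    exact ⟨_, key ht (.inl (cons_mem_controlPoints p []))⟩

end RegProg

theorem primrec_intCast : Primrec (Nat.cast : ℕ → ℤ) := by
  have h : Primrec fun n : ℕ => Encodable.encode (n : ℤ) :=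
    Primrec.nat_mul.comp (.const 2) .id
  exact Primrec.encode_iff.1 h

theorem primrec_const_pow (b : ℕ) : Primrec (b ^ ·) :=
  (Primrec.nat_rec₁ (f := fun _ y => y * b) 1
      (Primrec.nat_mul.comp .snd (.const b) : Primrec fun p : ℕ × ℕ => p.2 * b)).of_eq fun n => by
    induction n with
    | zero => rfl
    | succ n ih => rw [pow_succ, ← ih]

theorem RegProg.registerCode_update_zero {n : ℕ} (hn : 0 < n) (x : ℕ) :
    registerCode n (Function.update 0 0 x) = Nat.nth Nat.Prime 0 ^ x := by
  simp [registerCode_update hn]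

/-- It is undecidable whether Eve has a winning strategy in a
two-dimensional robot game with states in which Adam is stateless and none of
Adam's moves modifies the second counter. -/
theorem undecidable_RGS :
    ¬ ∃ f : RGSData → Bool, Computable f ∧
      ∀ d : RGSData, (∀ a ∈ d.2.1, a.2 = 0) →
        (f d = true ↔
          RGSEveWins { e | e ∈ d.1 } { a | a ∈ d.2.1 } (d.2.2.1, d.2.2.2)) := by
  rintro ⟨f, hf, hspec⟩
  obtain ⟨p, hp⟩ := RegProg.exists_universal
  obtain ⟨φ, hφ⟩ := exists_injective_nat (AffineGameState (List RegProg))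
  let x₀ (c : Nat.Partrec.Code) : ℕ := Nat.nth Nat.Prime 0 ^ Encodable.encode c
  let inst (c : Nat.Partrec.Code) : RGSData :=
    (affineMoves p.rules [] φ, [signal false, signal true], φ (.main [p] false),
      gamePos false (x₀ c) 0)
  have hpos : Primrec fun c => gamePos false (x₀ c) 0 := by
    have h3 : Primrec fun c => ((3 * x₀ c : ℕ) : ℤ) :=
      primrec_intCast.comp <| Primrec.nat_mul.comp (.const 3) <|
        (primrec_const_pow _).comp .encode
    exact (h3.pair (.const 0)).of_eq fun c => by simp [gamePos]
  have hinst : Computable inst :=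
    ((Primrec.const _).pair ((Primrec.const _).pair ((Primrec.const _).pair hpos))).to_comp
  refine ComputablePred.halting_problem 0 (ComputablePred.computable_iff.2
    ⟨fun c => f (inst c), hf.comp hinst, funext fun c => propext ?_⟩)
  rw [hspec (inst c) (by simp [inst, signal]), ← hp c,
    ← RegProg.affineHalts_rules_iff (le_max_left p.bound 1),
    RegProg.registerCode_update_zero (lt_max_of_lt_right one_pos)]
  refine (eveWins_affine_iff hφ (fun ρ hρ => ?_) [p]
    (pow_pos (Nat.prime_nth_prime 0).pos _)).symm
  obtain ⟨L, -, hL⟩ := List.mem_flatMap.1 hρ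
  exact RegProg.stepRules_pos hL
end
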